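/- arXiv:1704.08918 — 3 statements merged into one kernel-verified Lean document; each statement's English description precedes it below -/
import Mathlib

section
/- Every Riesz sequence (f_k)_{k∈ℤ} in a Hilbert space H has a representation f_k = T^k f_0 for a bounded, bijective linear operator T: span{f_k : k∈ℤ} → span{f_k : k∈ℤ} (whose inverse is also bounded). -/
/-- `f` is a Riesz sequence: there are `A, B > 0` with
`A Σ|c_k|² ≤ ‖Σ c_k f_k‖² ≤ B Σ|c_k|²` for all finitely supported `c`. -/
def IsRieszSeq {H : Type*} [NormedAddCommGroup H] [InnerProductSpace ℂ H]
    (f : ℤ → H) : Prop :=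
  ∃ A B : ℝ, 0 < A ∧ 0 < B ∧
    ∀ c : ℤ →₀ ℂ,
      A * ∑ k ∈ c.support, ‖c k‖ ^ 2 ≤ ‖∑ k ∈ c.support, c k • f k‖ ^ 2 ∧
      ‖∑ k ∈ c.support, c k • f k‖ ^ 2 ≤ B * ∑ k ∈ c.support, ‖c k‖ ^ 2

theorem IsRieszSeq.linearIndependent {H : Type*} [NormedAddCommGroup H] [InnerProductSpace ℂ H]
    {f : ℤ → H} (hf : IsRieszSeq f) : LinearIndependent ℂ f := by
  obtain ⟨A, B, hA, -, h⟩ := hf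
  rw [linearIndependent_iff]
  intro c hc
  have hlow := (h c).1
  rw [Finsupp.linearCombination_apply, Finsupp.sum] at hc
  rw [hc, norm_zero, zero_pow two_ne_zero] at hlow
  have hsum : ∑ k ∈ c.support, ‖c k‖ ^ 2 = 0 :=
    le_antisymm (nonpos_of_mul_nonpos_right hlow hA) (Finset.sum_nonneg fun _ _ => by positivity)
  rw [Finset.sum_eq_zero_iff_of_nonneg fun _ _ => by positivity] at hsum
  ext k
  by_contra hk
  exact hk (by simpa using hsum k (Finsupp.mem_support_iff.mpr hk))

/-- Permuting the coefficients of vectors in the span of a Riesz sequence is a bounded operation. -/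
theorem IsRieszSeq.exists_norm_equiv_le {H : Type*} [NormedAddCommGroup H]
    [InnerProductSpace ℂ H] {f : ℤ → H} (hf : IsRieszSeq f) (e : ℤ ≃ ℤ) :
    ∃ C : ℝ, ∀ v : Submodule.span ℂ (Set.range f),
      ‖((Module.Basis.span hf.linearIndependent).equiv
        (Module.Basis.span hf.linearIndependent) e v : H)‖ ≤ C * ‖(v : H)‖ := by
  set b := Module.Basis.span hf.linearIndependent with hb
  obtain ⟨A, B, hA, hB, h⟩ := id hf
  have hcoe (v : Submodule.span ℂ (Set.range f)) :
      ∑ k ∈ (b.repr v).support, b.repr v k • f k = (v : H) := by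
    conv_rhs => rw [← b.linearCombination_repr v]
    simp [Finsupp.linearCombination_apply, Finsupp.sum, hb, Module.Basis.span_apply]
  refine ⟨√(B / A), fun v => ?_⟩
  have hrepr : b.repr (b.equiv b e v) = (b.repr v).equivMapDomain e := by
    have hv : (b.reindex e.symm).repr (b.equiv b e v) = b.repr v :=
      (b.reindex e.symm).repr.apply_symm_apply (b.repr v)
    ext k
    rw [Finsupp.equivMapDomain_apply, ← hv, Module.Basis.repr_reindex_apply, Equiv.symm_symm,
      Equiv.apply_symm_apply]
  have hsum : ∑ k ∈ (b.repr (b.equiv b e v)).support, ‖b.repr (b.equiv b e v) k‖ ^ 2 =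
      ∑ k ∈ (b.repr v).support, ‖b.repr v k‖ ^ 2 := by
    rw [hrepr]
    exact Finsupp.sum_equivMapDomain e (b.repr v) fun _ x => ‖x‖ ^ 2
  have hlow := (h (b.repr v)).1
  have hup := (h (b.repr (b.equiv b e v))).2
  rw [hcoe] at hlow hup
  rw [hsum] at hup
  refine le_of_sq_le_sq ?_ (by positivity)
  rw [mul_pow, Real.sq_sqrt (by positivity)]
  calc _ ≤ _ := hup
    _ ≤ B * (‖(v : H)‖ ^ 2 / A) := by
      gcongr
      rwa [le_div_iff₀' hA]
    _ = _ := by ring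

/-- Corollary 2.4: every Riesz sequence `(f_k)_{k∈ℤ}` has a representation `f_k = T^k f_0`
for a bounded bijective operator `T : span{f_k} → span{f_k}` with bounded inverse. -/
theorem stmt5 {H : Type*} [NormedAddCommGroup H] [InnerProductSpace ℂ H] [CompleteSpace H]
    (f : ℤ → H) (hriesz : IsRieszSeq f) :
    ∃ T : (Submodule.span ℂ (Set.range f)) ≃ₗ[ℂ] (Submodule.span ℂ (Set.range f)),
      (∀ k : ℤ, (((T ^ k) ⟨f 0, Submodule.subset_span ⟨0, rfl⟩⟩ : _) : H) = f k) ∧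
      (∃ C : ℝ, ∀ v : (Submodule.span ℂ (Set.range f)), ‖(T v : H)‖ ≤ C * ‖(v : H)‖) ∧
      (∃ C : ℝ, ∀ v : (Submodule.span ℂ (Set.range f)), ‖(T.symm v : H)‖ ≤ C * ‖(v : H)‖) := by
  set b := Module.Basis.span hriesz.linearIndependent with hb
  have hbf (k : ℤ) : (b k : H) = f k := by simp [hb, Module.Basis.span_apply]
  set T := b.equiv b (Equiv.addRight 1) with hT
  have hTb (k : ℤ) : T (b k) = b (k + 1) := by simp [hT]
  have hpow (k : ℤ) : (T ^ k) (b 0) = b k := by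
    induction k with
    | zero => simp
    | succ n ih => rw [add_comm, zpow_add, zpow_one, LinearEquiv.mul_apply, ih, hTb, add_comm]
    | pred n ih =>
      apply T.injective
      rw [hTb, ← LinearEquiv.mul_apply, ← zpow_one_add, add_sub_cancel, ih, sub_add_cancel]
  refine ⟨T, fun k => ?_, hriesz.exists_norm_equiv_le _, ?_⟩
  · have h0 : (⟨f 0, Submodule.subset_span ⟨0, rfl⟩⟩ : Submodule.span ℂ (Set.range f)) = b 0 :=
      Subtype.ext (hbf 0).symm
    rw [h0, hpow, hbf]
  · rw [hT, Module.Basis.equiv_symm]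
    exact hriesz.exists_norm_equiv_le _
end

section
/- Let c = (c_k)_{k∈ℤ} be a nonzero element of ℓ²(ℤ) and let 𝒯 denote the right-shift operator on ℓ²(ℤ). Then the family {𝒯^j c : j = 1, 2, 3, ...} is linearly independent. -/
open Polynomial in
/-- Over an algebraically closed field, a nonzero polynomial in an endomorphism without
eigenvalues is injective. -/
theorem aeval_apply_ne_zero_of_forall_not_eigenvector {K V : Type*} [Field K] [IsAlgClosed K]
    [AddCommGroup V] [Module K V] {f : Module.End K V}
    (hf : ∀ (μ : K) (v : V), v ≠ 0 → f v ≠ μ • v) {p : K[X]} (hp : p ≠ 0) {v : V} (hv : v ≠ 0) :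
    aeval f p v ≠ 0 := by
  have key : ∀ s : Multiset K, aeval f (s.map fun a => X - C a).prod v ≠ 0 := by
    intro s
    induction s using Multiset.induction_on with
    | empty => simpa using hv
    | cons a s ih =>
      have h := hf a _ ih
      rw [← sub_ne_zero] at h
      simpa [Module.algebraMap_end_apply] using h
  rw [(IsAlgClosed.splits p).eq_prod_roots, map_mul, aeval_C, Module.End.mul_apply,
    Module.algebraMap_end_apply]
  exact smul_ne_zero (leadingCoeff_ne_zero.2 hp) (key _)

open Polynomial in
/-- Over an algebraically closed field, the iterates of an endomorphism without eigenvalues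
on a nonzero vector are linearly independent. -/
theorem linearIndependent_pow_apply_of_forall_not_eigenvector {K V : Type*} [Field K]
    [IsAlgClosed K] [AddCommGroup V] [Module K V] {f : Module.End K V}
    (hf : ∀ (μ : K) (v : V), v ≠ 0 → f v ≠ μ • v) {v : V} (hv : v ≠ 0) :
    LinearIndependent K (fun n : ℕ => (f ^ n) v) := by
  rw [linearIndependent_iff']
  intro s g hg i hi
  have hp : ∑ j ∈ s, monomial j (g j) = 0 := by
    by_contra hp
    refine aeval_apply_ne_zero_of_forall_not_eigenvector hf hp hv ?_
    simpa [aeval_monomial, LinearMap.sum_apply, Module.algebraMap_end_apply] using hg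
  simpa [finsetSum_coeff, coeff_monomial, hi] using congrArg (fun p => coeff p i) hp

/-- The entries of an `ℓ²(ℤ)` sequence cannot stay bounded below along an injective sequence of
indices. -/
theorem lp.eq_zero_of_forall_norm_le {c : lp (fun _ : ℤ => ℂ) 2} {k : ℤ} {u : ℕ → ℤ}
    (hu : Function.Injective u) (h : ∀ n, ‖c k‖ ≤ ‖c (u n)‖) : c k = 0 := by
  have hs : Summable fun i => ‖c i‖ ^ (2 : ℝ) := by
    simpa using (lp.memℓp c).summable (by norm_num)
  have ht := (hs.comp_injective hu).tendsto_atTop_zero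
  have hle : ‖c k‖ ^ (2 : ℝ) ≤ 0 :=
    ge_of_tendsto' ht fun n => Real.rpow_le_rpow (norm_nonneg _) (h n) (by norm_num)
  have hsq : ‖c k‖ ^ 2 ≤ 0 := by exact_mod_cast hle
  exact norm_eq_zero.1 (pow_eq_zero_iff two_ne_zero |>.1 (le_antisymm hsq (by positivity)))

/-- A square-summable sequence that is a multiple of its own shift vanishes. -/
theorem lp.eq_zero_of_shift_eq_mul {c : lp (fun _ : ℤ => ℂ) 2} {μ : ℂ}
    (h : ∀ k, c (k - 1) = μ * c k) : c = 0 := by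
  ext k
  rcases le_total 1 ‖μ‖ with hμ | hμ
  · refine lp.eq_zero_of_forall_norm_le (u := fun n : ℕ => k - n)
      (fun a b hab => by simpa using hab) fun n => ?_
    induction n with
    | zero => simp
    | succ n ih =>
      refine ih.trans ?_
      rw [show k - ((n + 1 : ℕ) : ℤ) = k - n - 1 by push_cast; ring, h, norm_mul]
      exact le_mul_of_one_le_left (norm_nonneg _) hμ
  · refine lp.eq_zero_of_forall_norm_le (u := fun n : ℕ => k + n)
      (fun a b hab => by simpa using hab) fun n => ?_
    induction n with
    | zero => simp
    | succ n ih =>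
      refine ih.trans ?_
      rw [show k + (n : ℤ) = k + ((n + 1 : ℕ) : ℤ) - 1 by push_cast; ring, h, norm_mul]
      exact mul_le_of_le_one_left (norm_nonneg _) hμ

/-- Key step in Corollary 2.5: for every nonzero `c ∈ ℓ²(ℤ)`, the family
`{𝒯^j c : j = 1, 2, 3, ...}` of iterated right-shifts of `c` is linearly independent. -/
theorem stmt7 (𝒯 : lp (fun _ : ℤ => ℂ) 2 →L[ℂ] lp (fun _ : ℤ => ℂ) 2)
    (h𝒯 : ∀ (c : lp (fun _ : ℤ => ℂ) 2) (k : ℤ), (𝒯 c) k = c (k - 1))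
    (c : lp (fun _ : ℤ => ℂ) 2) (hc : c ≠ 0) :
    LinearIndependent ℂ (fun j : ℕ => (𝒯 ^ (j + 1)) c) := by
  have hf : ∀ (μ : ℂ) (v : lp (fun _ : ℤ => ℂ) 2), v ≠ 0 →
      (𝒯 : Module.End ℂ (lp (fun _ : ℤ => ℂ) 2)) v ≠ μ • v := by
    intro μ v hv hμ
    refine hv (lp.eq_zero_of_shift_eq_mul (μ := μ) fun k => ?_)
    rw [← h𝒯, ← ContinuousLinearMap.coe_coe, hμ]
    simp
  have hli := (linearIndependent_pow_apply_of_forall_not_eigenvector hf hc).comp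
    (fun j : ℕ => j + 1) (add_left_injective 1)
  simpa only [Function.comp_def, ← ContinuousLinearMap.toLinearMap_pow,
    ContinuousLinearMap.coe_coe] using hli
end

section
/- Let (f_k)_{k=1}^∞ and (e_k)_{k=1}^∞ be two orthonormal bases of a Hilbert space H such that the combined family {f_k}_{k≥1} ∪ {e_k}_{k≥1} is linearly independent. Then any linear operator T: span({f_k} ∪ {e_k}) → H satisfying T f_k = e_k and T e_k = f_{k+1} for all k ≥ 1 (i.e., realizing the interleaved sequence f₁, e₁, f₂, e₂, ... as (T^k f₁)_{k≥0}) is unbounded. -/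
/-- Appendix lemma: let `(f_k)_{k≥1}` and `(e_k)_{k≥1}` be two orthonormal bases of `H` such
that the combined family `{f_k} ∪ {e_k}` is linearly independent. Then any linear operator
`T : span({f_k} ∪ {e_k}) → H` with `T f_k = e_k` and `T e_k = f_{k+1}` for all `k` (realizing
the interleaved sequence `f₁, e₁, f₂, e₂, …` as `(T^k f₁)_{k≥0}`) is unbounded. -/
theorem stmt19 {H : Type*} [NormedAddCommGroup H] [InnerProductSpace ℂ H] [CompleteSpace H]
    (f e : ℕ → H)
    (hf_on : Orthonormal ℂ f)
    (hf_total : (Submodule.span ℂ (Set.range f)).topologicalClosure = ⊤)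
    (he_on : Orthonormal ℂ e)
    (he_total : (Submodule.span ℂ (Set.range e)).topologicalClosure = ⊤)
    (hlin : LinearIndependent ℂ (Sum.elim f e))
    (T : (Submodule.span ℂ (Set.range f ∪ Set.range e)) →ₗ[ℂ] H)
    (hTf : ∀ k : ℕ, T ⟨f k, Submodule.subset_span (Or.inl ⟨k, rfl⟩)⟩ = e k)
    (hTe : ∀ k : ℕ, T ⟨e k, Submodule.subset_span (Or.inr ⟨k, rfl⟩)⟩ = f (k + 1)) :
    ¬ ∃ C : ℝ, ∀ v : (Submodule.span ℂ (Set.range f ∪ Set.range e)), ‖T v‖ ≤ C * ‖(v : H)‖ := by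
  rintro ⟨C, hC⟩
  let φ : (Submodule.span ℂ (Set.range f ∪ Set.range e)) →ₗ[ℂ] ℂ :=
    (innerSL ℂ (f 0)).toLinearMap ∘ₗ T
  have hφ (v) : φ v = inner ℂ (f 0) (T v) := rfl
  have hker : Submodule.span ℂ (Set.range e) ≤
      (LinearMap.ker φ).map (Submodule.subtype _) := by
    rw [Submodule.span_le]
    rintro _ ⟨k, rfl⟩
    refine ⟨⟨e k, Submodule.subset_span (Or.inr ⟨k, rfl⟩)⟩, ?_, rfl⟩
    change φ _ = 0
    rw [hφ, hTe]
    exact hf_on.2 (Nat.succ_ne_zero k).symm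
  have hbound (v) : ‖φ v‖ ≤ C * ‖(v : H)‖ := by
    calc ‖φ v‖ ≤ ‖f 0‖ * ‖T v‖ := norm_inner_le_norm _ _
      _ = ‖T v‖ := by rw [hf_on.1 0, one_mul]
      _ ≤ C * ‖(v : H)‖ := hC v
  have hC0 : 0 ≤ C := by
    have h := hC ⟨f 0, Submodule.subset_span (Or.inl ⟨0, rfl⟩)⟩
    rw [hf_on.1 0, mul_one] at h
    exact (norm_nonneg _).trans h
  have horth (k : ℕ) : inner ℂ (f 0) (e k) = 0 := by
    rw [← norm_le_zero_iff]
    refine le_of_forall_pos_le_add fun ε hε => ?_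
    have hmem : f k ∈ closure (Submodule.span ℂ (Set.range e) : Set H) := by
      rw [← Submodule.topologicalClosure_coe, he_total]
      trivial
    obtain ⟨v, hv, hd⟩ := Metric.mem_closure_iff.1 hmem (ε / (C + 1)) (by positivity)
    obtain ⟨w, hw, rfl⟩ := hker hv
    have hw' : φ w = 0 := hw
    have h := hbound (⟨f k, Submodule.subset_span (Or.inl ⟨k, rfl⟩)⟩ - w)
    rw [map_sub, hw', sub_zero, hφ, hTf] at h
    rw [dist_eq_norm, lt_div_iff₀ (by positivity)] at hd
    simp only [AddSubgroupClass.coe_sub, Submodule.subtype_apply] at h hd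
    linarith [norm_nonneg (f k - (w : H))]
  have hle : Submodule.span ℂ (Set.range e) ≤ (ℂ ∙ f 0)ᗮ := by
    rw [Submodule.span_le]
    rintro _ ⟨k, rfl⟩
    exact Submodule.mem_orthogonal_singleton_iff_inner_right.2 (horth k)
  have hself : f 0 ∈ (ℂ ∙ f 0)ᗮ := by
    apply Submodule.topologicalClosure_minimal _ hle (Submodule.isClosed_orthogonal _)
    rw [he_total]
    trivial
  exact hf_on.ne_zero 0
    (inner_self_eq_zero.1 (Submodule.mem_orthogonal_singleton_iff_inner_right.1 hself))
end
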